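/- For α ∈ (0,1] and all x > 0, the inequality x(1+x²)(1+x^{2/α}) ≥ x^{1/α}·((1+x²)² − 4x²cos²(απ/2))/sin²(απ/2) holds (equivalently, g(x) ≥ 1/sin²(απ/2) where g is as in the starlikeness proof), with equality at x = 1. -/

import Mathlib

open Real

lemma aux_pow (A B C : ℝ) (hB : 0 ≤ B) (hBA : B ≤ A) (hC : 0 ≤ C) (hCA : C ≤ A)
    (h2 : B * (C - B) ≤ A * (A - C)) (n : ℕ) :
    (A + B) * C ^ n ≤ A ^ (n+1) + B ^ (n+1) := by
  induction n with
  | zero => simp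
  | succ k ih =>
    have h1 : C * ((A + B) * C ^ k) ≤ C * (A ^ (k+1) + B ^ (k+1)) :=
      mul_le_mul_of_nonneg_left ih hC
    have hk : B ^ k ≤ A ^ k := pow_le_pow_left₀ hB hBA k
    have hA : 0 ≤ A := hB.trans hBA
    have h3 : B ^ k * (B * (C - B)) ≤ B ^ k * (A * (A - C)) :=
      mul_le_mul_of_nonneg_left h2 (pow_nonneg hB k)
    have h4 : B ^ k * (A * (A - C)) ≤ A ^ k * (A * (A - C)) :=
      mul_le_mul_of_nonneg_right hk (mul_nonneg hA (sub_nonneg.2 hCA))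
    have e : A ^ (k+1+1) + B ^ (k+1+1) - (A + B) * C ^ (k+1)
      = (A ^ k * (A * (A - C)) - B ^ k * (B * (C - B)))
        + (C * (A ^ (k+1) + B ^ (k+1)) - C * ((A + B) * C ^ k)) := by ring
    linarith

lemma aux_cosh (a t : ℝ) (h0 : 0 < a) (h1 : a ≤ 1) :
    (1 + a^2) * sinh (a*t) ^ 2 ≤ 2 * a^2 * (cosh (a*t) * cosh t - 1) := by
  have s1 := (Real.hasSum_cosh ((1+a)*t)).mul_left (a^2)
  have s2 := (Real.hasSum_cosh ((1-a)*t)).mul_left (a^2)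
  have s3 := (Real.hasSum_cosh (2*(a*t))).mul_left ((1+a^2)/2)
  have s4 := hasSum_ite_eq (0:ℕ) (2*a^2 - (1+a^2)/2)
  have s := ((s1.add s2).sub s3).sub s4
  have key := s.nonneg (fun n => by
    rcases n with _ | n
    · simp; linarith
    · have hp := aux_pow ((1+a)^2) ((1-a)^2) (4*a^2) (by positivity) (by nlinarith)
        (by positivity) (by nlinarith) (by
          have : 0 ≤ (1 - a^2) * (1 + 3 * a^2) :=
            mul_nonneg (by nlinarith) (by positivity)
          nlinarith) n
      have hq : 0 ≤ a^2 * (t^(2*(n+1)) / ((2*(n+1)).factorial : ℝ)) := by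
        have : 0 ≤ t^(2*(n+1)) := by rw [pow_mul]; positivity
        positivity
      have := mul_nonneg hq (sub_nonneg.2 hp)
      simp only [Nat.add_eq_zero_iff, one_ne_zero, and_false, if_false, sub_zero]
      refine this.trans_eq ?_
      simp only [mul_pow, pow_mul]
      ring)
  have e1 : cosh ((1+a)*t) = cosh t * cosh (a*t) + sinh t * sinh (a*t) := by
    rw [← cosh_add]; ring_nf
  have e2 : cosh ((1-a)*t) = cosh t * cosh (a*t) - sinh t * sinh (a*t) := by
    rw [← cosh_sub]; ring_nf
  rw [e1, e2, cosh_two_mul, cosh_sq] at key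
  nlinarith

lemma aux_sin (a : ℝ) (h0 : 0 < a) (h1 : a ≤ 1) :
    2 * a^2 ≤ (1 + a^2) * sin (a * π / 2) ^ 2 := by
  have p1 := Real.pi_gt_d4
  have p2 := Real.pi_lt_d4
  have q1 : 2.46 ≤ π^2/4 := by nlinarith
  have q2 : π^2/4 ≤ 2.47 := by nlinarith
  rcases le_total a 0.6 with h | h
  · have hs := Real.sin_gt_sub_cube (x := a*π/2) (by positivity)
    have ha : a^2 ≤ 0.36 := by nlinarith
    have ha0 : 0 ≤ a^2 := sq_nonneg a
    have hm : 0 ≤ 1 - 0.6175 * a^2 := by linarith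
    have hb : (a*π/2) * (1 - 0.6175 * a^2) ≤ sin (a*π/2) := by
      have : (a*π/2) * (1 - 0.6175 * a^2) ≤ (a*π/2) * (1 - (π^2/4) * a^2 / 4) := by
        apply mul_le_mul_of_nonneg_left _ (by positivity)
        nlinarith
      have h3 : 0 ≤ (a*π/2)^3 := by positivity
      linarith
    have hb0 : 0 ≤ (a*π/2) * (1 - 0.6175 * a^2) := by positivity
    have hsq := pow_le_pow_left₀ hb0 hb 2
    have e : ((a*π/2) * (1 - 0.6175 * a^2))^2 = a^2 * ((π^2/4) * (1 - 0.6175 * a^2)^2) := by ring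
    rw [e] at hsq
    have h5 : 2.46 * (1 - 0.6175 * a^2)^2 ≤ (π^2/4) * (1 - 0.6175 * a^2)^2 :=
      mul_le_mul_of_nonneg_right q1 (sq_nonneg _)
    have h6 : 2 ≤ (1 + a^2) * (2.46 * (1 - 0.6175 * a^2)^2) := by
      generalize a^2 = b at *
      nlinarith [mul_nonneg ha0 (sub_nonneg.2 ha), mul_nonneg ha0 (mul_nonneg ha0 ha0)]
    calc 2 * a^2 ≤ a^2 * ((1 + a^2) * (2.46 * (1 - 0.6175 * a^2)^2)) := by nlinarith
      _ ≤ a^2 * ((1 + a^2) * ((π^2/4) * (1 - 0.6175 * a^2)^2)) := by gcongr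
      _ = (1 + a^2) * (a^2 * ((π^2/4) * (1 - 0.6175 * a^2)^2)) := by ring
      _ ≤ _ := by gcongr
  · have hφ : sin (a*π/2) = cos ((1-a)*π/2) := by
      rw [← Real.cos_pi_div_two_sub]; ring_nf
    have hle : sin ((1-a)*π/2) ≤ (1-a)*π/2 :=
      Real.sin_le (div_nonneg (mul_nonneg (by linarith) (by linarith)) (by norm_num))
    have h0' : 0 ≤ sin ((1-a)*π/2) :=
      Real.sin_nonneg_of_nonneg_of_le_pi
        (div_nonneg (mul_nonneg (by linarith) (by linarith)) (by norm_num)) (by nlinarith)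
    have hsq := pow_le_pow_left₀ h0' hle 2
    have e : ((1-a)*π/2)^2 = (π^2/4) * (1-a)^2 := by ring
    rw [hφ, Real.cos_sq']
    have h5 : (π^2/4) * (1-a)^2 ≤ 2.47 * (1-a)^2 := by gcongr
    have h6 : 2.47 * (1-a) * (1+a^2) ≤ 1 + a := by
      nlinarith [mul_nonneg (sub_nonneg.2 h) (sub_nonneg.2 h1), mul_nonneg (sub_nonneg.2 h) (sq_nonneg a)]
    have h7 := mul_le_mul_of_nonneg_left h6 (sub_nonneg.2 h1)
    have h8 : (1 + a^2) * sin ((1-a)*π/2)^2 ≤ (1+a^2) * (2.47 * (1-a)^2) := by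
      apply mul_le_mul_of_nonneg_left _ (by positivity)
      linarith
    nlinarith

theorem lens_starlike_ineq (α : ℝ) (hα : α ∈ Set.Ioc (0:ℝ) 1) :
    (∀ x > (0:ℝ),
      x * (1 + x^2) * (1 + x ^ ((2:ℝ)/α)) ≥
        x ^ ((1:ℝ)/α) * ((1 + x^2)^2 - 4 * x^2 * (Real.cos (α * π / 2))^2) /
          (Real.sin (α * π / 2))^2) ∧
    (1:ℝ) * (1 + 1^2) * (1 + (1:ℝ) ^ ((2:ℝ)/α)) =
      (1:ℝ) ^ ((1:ℝ)/α) * ((1 + 1^2)^2 - 4 * 1^2 * (Real.cos (α * π / 2))^2) /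
        (Real.sin (α * π / 2))^2 := by
  obtain ⟨h0, h1⟩ := hα
  have hs := aux_sin α h0 h1
  have hS : 0 < sin (α * π / 2) ^ 2 := by
    by_contra hc
    have : 0 < α^2 := by positivity
    nlinarith [sq_nonneg (sin (α * π / 2))]
  constructor
  · intro x hx
    obtain ⟨t, rfl⟩ : ∃ t, x = exp (α * t) :=
      ⟨log x / α, by rw [mul_div_cancel₀ _ h0.ne', exp_log hx]⟩
    have e1 : exp (α * t) ^ ((1:ℝ)/α) = exp t := by
      rw [← Real.exp_mul]; congr 1; field_simp
    have e2 : exp (α * t) ^ ((2:ℝ)/α) = exp t ^ 2 := by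
      rw [← Real.exp_mul, ← Real.exp_nat_mul]; congr 1; push_cast; field_simp
    rw [e1, e2, ge_iff_le, div_le_iff₀ hS, Real.cos_sq']
    have hc := aux_cosh α t h0 h1
    have f1 : 1 + exp (α*t)^2 = 2 * exp (α*t) * cosh (α*t) := by
      rw [cosh_eq, Real.exp_neg]; field_simp
      try ring
    have f2 : 1 + exp t^2 = 2 * exp t * cosh t := by
      rw [cosh_eq, Real.exp_neg]; field_simp
      try ring
    rw [f1, f2]
    have hX : 0 ≤ cosh (α*t) * cosh t - 1 := by
      nlinarith [one_le_cosh (α*t), one_le_cosh t]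
    have hm := mul_le_mul_of_nonneg_right hs hX
    have hfin : sinh (α*t)^2 ≤ sin (α*π/2)^2 * (cosh (α*t) * cosh t - 1) := by
      have : 0 < 1 + α^2 := by positivity
      refine le_of_mul_le_mul_left ?_ this
      linarith
    rw [Real.sinh_sq] at hfin
    have hp : 0 ≤ 4 * exp t * exp (α*t)^2 := by positivity
    have := mul_le_mul_of_nonneg_left hfin hp
    linarith
  · rw [Real.one_rpow, Real.one_rpow, eq_div_iff hS.ne', Real.cos_sq']
    ring
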